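/- There is a universal constant C > 0 such that for any isotropic logconcave probability density p on ℝⁿ and any L-Lipschitz function g : ℝⁿ → ℝ, the mean and any median of g under p differ by at most C·L·n^{1/4}: | E_{x∼p} g(x) − m_g | ≤ C·L·n^{1/4}. -/

import Mathlib

open MeasureTheory Real Filter
open scoped RealInnerProductSpace Topology

noncomputable section

/-- Euclidean space `ℝⁿ`. -/
abbrev En (n : ℕ) := EuclideanSpace ℝ (Fin n)

/-- A nonnegative function which is logconcave. -/
def IsLogConcave {n : ℕ} (p : En n → ℝ) : Prop :=
  (∀ x, 0 ≤ p x) ∧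
  ∀ x y : En n, ∀ t : ℝ, 0 ≤ t → t ≤ 1 →
    p x ^ t * p y ^ (1 - t) ≤ p (t • x + (1 - t) • y)

/-- A probability density on `ℝⁿ` (w.r.t. Lebesgue measure). -/
def IsDensity {n : ℕ} (p : En n → ℝ) : Prop :=
  Integrable p ∧ (∫ x, p x) = 1

/-- The measure of a set under the density `p`. -/
def pmeas {n : ℕ} (p : En n → ℝ) (S : Set (En n)) : ℝ := ∫ x in S, p x

/-- Mean of the density `p`. -/
def pmean {n : ℕ} (p : En n → ℝ) : En n := ∫ x, p x • x

/-- Covariance matrix of the density `p`. -/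
def pcov {n : ℕ} (p : En n → ℝ) : Matrix (Fin n) (Fin n) ℝ :=
  fun i j => ∫ x, p x * ((x i - pmean p i) * (x j - pmean p j))

/-- Isotropic: mean zero and identity covariance. -/
def IsIsotropic {n : ℕ} (p : En n → ℝ) : Prop :=
  pmean p = 0 ∧ pcov p = 1

/-- Boundary measure `p(∂S)`, via the lower Minkowski content. -/
def bm {n : ℕ} (p : En n → ℝ) (S : Set (En n)) : ℝ :=
  liminf (fun ε : ℝ => (pmeas p (Metric.thickening ε S) - pmeas p S) / ε) (𝓝[>] 0)

end

/-- `m` is a median of `g` under the density `p`. -/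
def IsMedian {n : ℕ} (p g : En n → ℝ) (m : ℝ) : Prop :=
  1 / 2 ≤ pmeas p {x | m ≤ g x} ∧ 1 / 2 ≤ pmeas p {x | g x ≤ m}

/-! ### The Prékopa–Leindler inequality at the midpoint -/

open scoped Pointwise in
/-- The one-dimensional Brunn–Minkowski inequality, for compact sets. -/
lemma volume_add_le_of_midpoint_isCompact {K L S : Set ℝ} (hK : IsCompact K) (hL : IsCompact L)
    (hK' : K.Nonempty) (hL' : L.Nonempty) (h : ∀ a ∈ K, ∀ b ∈ L, (a + b) / 2 ∈ S) :
    volume K + volume L ≤ 2 * volume S := by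
  obtain ⟨k, hk, hkm⟩ := hK.exists_isGreatest hK'
  obtain ⟨l, hl, hlm⟩ := hL.exists_isLeast hL'
  have key : ∀ (T : Set ℝ) (c : ℝ), volume ((fun x => (x + c) / 2) '' T) = volume T / 2 := by
    intro T c
    have : (fun x : ℝ => (x + c) / 2) '' T = (fun x => x + c / 2) '' ((2⁻¹ : ℝ) • T) := by
      rw [← Set.image_smul, Set.image_image]
      refine Set.image_congr fun x _ => ?_
      simp only [smul_eq_mul]
      ring
    rw [this, Set.image_add_right, measure_preimage_add_right, Measure.addHaar_smul]
    simp only [Module.finrank_self, pow_one]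
    rw [abs_of_pos (by norm_num), ENNReal.ofReal_inv_of_pos (by norm_num), ENNReal.div_eq_inv_mul]
    simp
  have hKm : IsCompact ((fun x => (x + l) / 2) '' K) := hK.image (by fun_prop)
  have hLm : IsCompact ((fun x => (x + k) / 2) '' L) := hL.image (by fun_prop)
  have hdisj : AEDisjoint volume ((fun x => (x + l) / 2) '' K) ((fun x => (x + k) / 2) '' L) := by
    refine measure_mono_null (t := {(k + l) / 2}) ?_ (by simp)
    rintro _ ⟨⟨x, hx, rfl⟩, ⟨y, hy, hxy⟩⟩
    have := hkm hx
    have := hlm hy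
    simp only [Set.mem_singleton_iff] at *
    linarith
  have hunion := measure_union₀ (μ := volume) hLm.measurableSet.nullMeasurableSet hdisj
  have hsub : ((fun x => (x + l) / 2) '' K) ∪ ((fun x => (x + k) / 2) '' L) ⊆ S := by
    rintro _ (⟨x, hx, rfl⟩ | ⟨y, hy, rfl⟩)
    · exact h x hx l hl
    · simpa [add_comm] using h k hk y hy
  have := measure_mono (μ := volume) hsub
  rw [hunion, key, key, ← ENNReal.add_div] at this
  rw [mul_comm]
  exact (ENNReal.div_le_iff_le_mul (by simp) (by simp)).1 this

/-- The one-dimensional Brunn–Minkowski inequality. -/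
lemma volume_add_le_of_midpoint {A B S : Set ℝ} (hA : MeasurableSet A) (hB : MeasurableSet B)
    (hA' : A.Nonempty) (hB' : B.Nonempty) (h : ∀ a ∈ A, ∀ b ∈ B, (a + b) / 2 ∈ S) :
    volume A + volume B ≤ 2 * volume S := by
  obtain ⟨a, ha⟩ := hA'
  obtain ⟨b, hb⟩ := hB'
  rw [hA.measure_eq_iSup_isCompact, hB.measure_eq_iSup_isCompact]
  simp only [iSup_and']
  refine ENNReal.biSup_add_biSup_le' ⟨∅, by simp⟩ ⟨∅, by simp⟩ ?_
  rintro K ⟨hKA, hK⟩ L ⟨hLB, hL⟩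
  calc volume K + volume L ≤ volume (insert a K) + volume (insert b L) := by
        gcongr <;> exact Set.subset_insert _ _
    _ ≤ 2 * volume S := by
        refine volume_add_le_of_midpoint_isCompact (hK.insert a) (hL.insert b) ⟨a, by simp⟩
          ⟨b, by simp⟩ fun x hx y hy => h x ?_ y ?_
        · exact Set.insert_subset ha hKA hx
        · exact Set.insert_subset hb hLB hy

lemma lintegral_ofReal_eq_setLIntegral_Ioo {f : ℝ → ℝ} (hf : Measurable f) (f0 : ∀ x, 0 ≤ f x)
    (f1 : ∀ x, f x ≤ 1) :
    ∫⁻ x, ENNReal.ofReal (f x) = ∫⁻ t in Set.Ioo (0 : ℝ) 1, volume {x | t < f x} := by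
  rw [lintegral_eq_lintegral_meas_lt _ (ae_of_all _ f0) hf.aemeasurable,
    ← Set.Ioo_union_Ici_eq_Ioi (zero_lt_one' ℝ), lintegral_union measurableSet_Ici]
  · rw [setLIntegral_congr_fun (g := fun _ => 0) measurableSet_Ici]
    · simp
    · intro t ht
      have : {x | t < f x} = ∅ := by
        ext x
        simpa using (f1 x).trans ht
      simp [this]
  · exact Set.disjoint_left.2 fun x hx hx' => not_lt.2 hx' hx.2

lemma lintegral_add_le_of_midpoint {f g h : ℝ → ℝ} (hf : Measurable f) (hg : Measurable g)
    (hh : Measurable h) (f0 : ∀ x, 0 ≤ f x) (g0 : ∀ x, 0 ≤ g x) (h0 : ∀ x, 0 ≤ h x)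
    (f1 : ∀ x, f x ≤ 1) (g1 : ∀ x, g x ≤ 1) (f2 : ∀ t < 1, ∃ x, t < f x)
    (g2 : ∀ t < 1, ∃ x, t < g x) (H : ∀ x y, f x * g y ≤ h ((x + y) / 2) ^ 2) :
    (∫⁻ x, ENNReal.ofReal (f x)) + ∫⁻ x, ENNReal.ofReal (g x)
      ≤ 2 * ∫⁻ x, ENNReal.ofReal (h x) := by
  have hm : ∀ f : ℝ → ℝ, Measurable fun t : ℝ => volume {x | t < f x} := by
    intro f
    refine Antitone.measurable fun s t hst => measure_mono fun x hx => ?_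
    exact lt_of_le_of_lt hst hx
  rw [lintegral_ofReal_eq_setLIntegral_Ioo hf f0 f1, lintegral_ofReal_eq_setLIntegral_Ioo hg g0 g1,
    lintegral_eq_lintegral_meas_lt _ (ae_of_all _ h0) hh.aemeasurable, ← lintegral_add_left (hm f),
    ← lintegral_const_mul _ (hm h)]
  refine le_trans ?_ (lintegral_mono_set (s := Set.Ioo (0 : ℝ) 1) fun t ht => ht.1)
  refine setLIntegral_mono' measurableSet_Ioo fun t ht => ?_
  refine volume_add_le_of_midpoint (measurableSet_lt measurable_const hf)
    (measurableSet_lt measurable_const hg) (f2 t ht.2) (g2 t ht.2) fun x hx y hy => ?_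
  simp only [Set.mem_ofPred_eq] at *
  refine lt_of_pow_lt_pow_left₀ 2 (h0 _) (lt_of_lt_of_le ?_ (H x y))
  nlinarith [ht.1]

lemma lintegral_mul_le_of_midpoint_bounded {f g h : ℝ → ℝ} (hf : Measurable f) (hg : Measurable g)
    (hh : Measurable h) (f0 : ∀ x, 0 ≤ f x) (g0 : ∀ x, 0 ≤ g x) (h0 : ∀ x, 0 ≤ h x)
    (f1 : BddAbove (Set.range f)) (g1 : BddAbove (Set.range g))
    (H : ∀ x y, f x * g y ≤ h ((x + y) / 2) ^ 2) :
    (∫⁻ x, ENNReal.ofReal (f x)) * ∫⁻ x, ENNReal.ofReal (g x)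
      ≤ (∫⁻ x, ENNReal.ofReal (h x)) ^ 2 := by
  set α := ⨆ x, f x with hα
  set β := ⨆ x, g x with hβ
  have fα : ∀ x, f x ≤ α := le_ciSup f1
  have gβ : ∀ x, g x ≤ β := le_ciSup g1
  rcases (f0 0 |>.trans (fα 0)).eq_or_lt with h1 | hαp
  · have : ∀ x, f x = 0 := fun x => le_antisymm (h1 ▸ fα x) (f0 x)
    simp [this]
  rcases (g0 0 |>.trans (gβ 0)).eq_or_lt with h1 | hβp
  · have : ∀ x, g x = 0 := fun x => le_antisymm (h1 ▸ gβ x) (g0 x)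
    simp [this]
  have hsq : √(α * β) ^ 2 = α * β := sq_sqrt (by positivity)
  have hsp : 0 < √(α * β) := by positivity
  have key := lintegral_add_le_of_midpoint (f := fun x => f x / α) (g := fun x => g x / β)
    (h := fun x => h x / √(α * β)) (by fun_prop) (by fun_prop) (by fun_prop)
    (fun x => div_nonneg (f0 x) hαp.le) (fun x => div_nonneg (g0 x) hβp.le)
    (fun x => div_nonneg (h0 x) hsp.le) (fun x => (div_le_one hαp).2 (fα x))
    (fun x => (div_le_one hβp).2 (gβ x))
    (fun t ht => by
      obtain ⟨x, hx⟩ := exists_lt_of_lt_ciSup (show t * α < ⨆ x, f x by nlinarith)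
      exact ⟨x, (lt_div_iff₀ hαp).2 hx⟩)
    (fun t ht => by
      obtain ⟨x, hx⟩ := exists_lt_of_lt_ciSup (show t * β < ⨆ x, g x by nlinarith)
      exact ⟨x, (lt_div_iff₀ hβp).2 hx⟩)
    (fun x y => by
      rw [div_mul_div_comm, div_pow, hsq]
      gcongr
      exact H x y)
  have scale : ∀ {u : ℝ → ℝ} {c : ℝ}, 0 < c → Measurable u →
      ∫⁻ x, ENNReal.ofReal (u x) = ENNReal.ofReal c * ∫⁻ x, ENNReal.ofReal (u x / c) := by
    intro u c hc hu
    rw [← lintegral_const_mul _ (by fun_prop)]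
    refine lintegral_congr fun x => ?_
    rw [← ENNReal.ofReal_mul hc.le, mul_div_cancel₀ _ hc.ne']
  rw [scale hαp hf, scale hβp hg, scale hsp hh]
  generalize (∫⁻ x, ENNReal.ofReal (f x / α)) = F at *
  generalize (∫⁻ x, ENNReal.ofReal (g x / β)) = G at *
  generalize (∫⁻ x, ENNReal.ofReal (h x / √(α * β))) = J at *
  rw [mul_pow, ← ENNReal.ofReal_pow hsp.le, hsq, mul_mul_mul_comm, ← ENNReal.ofReal_mul hαp.le]
  gcongr
  rcases eq_or_ne J ⊤ with rfl | hJ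
  · simp
  have hF : F ≠ ⊤ := fun hF => by simp [hF, ENNReal.mul_eq_top, hJ] at key
  have hG : G ≠ ⊤ := fun hG => by simp [hG, ENNReal.mul_eq_top, hJ] at key
  lift J to NNReal using hJ
  lift F to NNReal using hF
  lift G to NNReal using hG
  norm_cast at key ⊢
  rw [← NNReal.coe_le_coe] at key ⊢
  push_cast at key ⊢
  have := F.coe_nonneg
  have := G.coe_nonneg
  nlinarith [sq_nonneg ((F : ℝ) - G)]

open scoped ENNReal in
/-- The midpoint Prékopa–Leindler inequality on the real line. -/
lemma lintegral_mul_le_of_midpoint_real {f g h : ℝ → ℝ≥0∞} (hf : Measurable f) (hg : Measurable g)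
    (hh : Measurable h) (H : ∀ x y, f x * g y ≤ h ((x + y) / 2) ^ 2) :
    (∫⁻ x, f x) * ∫⁻ x, g x ≤ (∫⁻ x, h x) ^ 2 := by
  have trunc : ∀ u : ℝ → ℝ≥0∞, Measurable u →
      ∫⁻ x, u x = ⨆ N : ℕ, ∫⁻ x, min (u x) N := by
    intro u hu
    rw [← lintegral_iSup (f := fun (N : ℕ) x => min (u x) N) (fun N => by fun_prop)
      (fun M N hMN x => min_le_min_left _ (by exact_mod_cast hMN))]
    refine lintegral_congr fun x => ?_
    rw [← inf_iSup_eq, ENNReal.iSup_natCast, inf_top_eq]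
  rw [trunc f hf, trunc g hg, ENNReal.iSup_mul]
  refine iSup_le fun N => ?_
  rw [ENNReal.mul_iSup]
  refine iSup_le fun M => ?_
  have real : ∀ u : ℝ → ℝ≥0∞, ∀ K : ℕ,
      ∫⁻ x, min (u x) K = ∫⁻ x, ENNReal.ofReal (min (u x) K).toReal := by
    intro u K
    refine lintegral_congr fun x => ?_
    rw [ENNReal.ofReal_toReal (by simp)]
  have bdd : ∀ u : ℝ → ℝ≥0∞, ∀ K : ℕ,
      BddAbove (Set.range fun x => (min (u x) (K : ℝ≥0∞)).toReal) := by
    refine fun u K => ⟨K, ?_⟩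
    rintro _ ⟨x, rfl⟩
    exact ENNReal.toReal_le_of_le_ofReal (by positivity) (by simp)
  calc _ ≤ (∫⁻ x, min (h x) ((max N M : ℕ) : ℝ≥0∞)) ^ 2 := by
        rw [real f, real g, real h]
        refine lintegral_mul_le_of_midpoint_bounded (by fun_prop) (by fun_prop) (by fun_prop)
          (fun _ => ENNReal.toReal_nonneg) (fun _ => ENNReal.toReal_nonneg)
          (fun _ => ENNReal.toReal_nonneg) (bdd _ _) (bdd _ _) fun x y => ?_
        rw [← ENNReal.toReal_mul, ← ENNReal.toReal_pow]
        refine ENNReal.toReal_mono (ENNReal.pow_ne_top (by simp)) ?_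
        rcases le_total (h ((x + y) / 2)) ((max N M : ℕ) : ℝ≥0∞) with hle | hle
        · rw [min_eq_left hle]
          exact (mul_le_mul' (min_le_left _ _) (min_le_left _ _)).trans (H x y)
        · rw [min_eq_right hle, sq]
          refine mul_le_mul' ((min_le_right _ _).trans ?_) ((min_le_right _ _).trans ?_) <;>
            exact_mod_cast (by simp)
    _ ≤ _ := by
        gcongr
        exact min_le_left _ _

open scoped ENNReal in
/-- The midpoint Prékopa–Leindler inequality on `Fin n → ℝ`. -/
lemma lintegral_mul_le_of_midpoint_pi (n : ℕ) {f g h : (Fin n → ℝ) → ℝ≥0∞} (hf : Measurable f)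
    (hg : Measurable g) (hh : Measurable h)
    (H : ∀ x y, f x * g y ≤ h ((2⁻¹ : ℝ) • (x + y)) ^ 2) :
    (∫⁻ x, f x) * ∫⁻ x, g x ≤ (∫⁻ x, h x) ^ 2 := by
  induction n with
  | zero =>
    simp only [lintegral_unique, volume_pi, Measure.pi_univ, Finset.univ_eq_empty,
      Finset.prod_empty, mul_one]
    convert H default default
  | succ n ih =>
    have symm_apply : ∀ p : ℝ × (Fin n → ℝ),
        (MeasurableEquiv.piFinSuccAbove (fun _ => ℝ) 0).symm p = Fin.cons p.1 p.2 := by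
      intro p
      ext i
      refine Fin.cases ?_ (fun j => ?_) i <;> simp [MeasurableEquiv.piFinSuccAbove]
    have split : ∀ u : (Fin (n + 1) → ℝ) → ℝ≥0∞, Measurable u →
        ∫⁻ x, u x = ∫⁻ a : ℝ, ∫⁻ b : Fin n → ℝ, u (Fin.cons a b) := by
      intro u hu
      rw [← (volume_preserving_piFinSuccAbove (fun _ => ℝ) 0).symm.lintegral_comp hu,
        Measure.volume_eq_prod, lintegral_prod _ (by fun_prop)]
      simp only [symm_apply]
    have meas : ∀ u : (Fin (n + 1) → ℝ) → ℝ≥0∞, Measurable u →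
        Measurable fun p : ℝ × (Fin n → ℝ) => u (Fin.cons p.1 p.2) := by
      intro u hu
      simp only [← symm_apply]
      fun_prop
    rw [split f hf, split g hg, split h hh]
    refine lintegral_mul_le_of_midpoint_real (meas f hf).lintegral_prod_right'
      (meas g hg).lintegral_prod_right' (meas h hh).lintegral_prod_right' fun a b => ?_
    refine ih ((meas f hf).comp measurable_prodMk_left) ((meas g hg).comp measurable_prodMk_left)
      ((meas h hh).comp measurable_prodMk_left) fun x y => ?_
    convert H (Fin.cons a x) (Fin.cons b y) using 3
    ext i
    refine Fin.cases ?_ (fun j => ?_) i <;> simp [div_eq_inv_mul, mul_add]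

open scoped ENNReal in
/-- The midpoint Prékopa–Leindler inequality on Euclidean space. -/
lemma lintegral_mul_le_of_midpoint {n : ℕ} {f g h : EuclideanSpace ℝ (Fin n) → ℝ≥0∞}
    (hf : Measurable f) (hg : Measurable g) (hh : Measurable h)
    (H : ∀ x y, f x * g y ≤ h ((2⁻¹ : ℝ) • (x + y)) ^ 2) :
    (∫⁻ x, f x) * ∫⁻ x, g x ≤ (∫⁻ x, h x) ^ 2 := by
  have hp := PiLp.volume_preserving_toLp (Fin n)
  rw [← hp.lintegral_comp hf, ← hp.lintegral_comp hg, ← hp.lintegral_comp hh]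
  refine lintegral_mul_le_of_midpoint_pi n (hf.comp hp.measurable) (hg.comp hp.measurable)
    (hh.comp hp.measurable) fun x y => ?_
  simpa using H (WithLp.toLp 2 x) (WithLp.toLp 2 y)

/-! ### Midpoint logconcave densities -/

open scoped ENNReal in
/-- A measurable `ℝ≥0∞`-valued density that is logconcave at midpoints. -/
structure IsMidLogConcave {n : ℕ} (w : EuclideanSpace ℝ (Fin n) → ℝ≥0∞) : Prop where
  measurable : Measurable w
  mul_le : ∀ x y, w x * w y ≤ w ((2⁻¹ : ℝ) • (x + y)) ^ 2

open scoped ENNReal in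
lemma setLIntegral_mul_le_of_midpoint {n : ℕ} {w : EuclideanSpace ℝ (Fin n) → ℝ≥0∞}
    (hw : Measurable w) {A D S : Set (EuclideanSpace ℝ (Fin n))} (hA : MeasurableSet A)
    (hD : MeasurableSet D) (hS : MeasurableSet S) {c : ℝ≥0∞}
    (H : ∀ a ∈ A, ∀ d ∈ D, (2⁻¹ : ℝ) • (a + d) ∈ S ∧
      c * (w a * w d) ≤ w ((2⁻¹ : ℝ) • (a + d)) ^ 2) :
    c * ((∫⁻ x in A, w x) * ∫⁻ x in D, w x) ≤ (∫⁻ x in S, w x) ^ 2 := by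
  rw [← lintegral_indicator hA, ← lintegral_indicator hD, ← lintegral_indicator hS, ← mul_assoc,
    ← lintegral_const_mul _ (hw.indicator hA)]
  refine lintegral_mul_le_of_midpoint ((hw.indicator hA).const_mul c) (hw.indicator hD)
    (hw.indicator hS) fun x y => ?_
  by_cases hx : x ∈ A
  · by_cases hy : y ∈ D
    · obtain ⟨h1, h2⟩ := H x hx y hy
      rw [Set.indicator_of_mem hx, Set.indicator_of_mem hy, Set.indicator_of_mem h1, mul_assoc]
      exact h2
    · simp [hy]
  · simp [hx]

open scoped ENNReal in
/-- Concentration for Gaussian tilts of a logconcave measure: two sets at distance `R` cannot both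
have large measure. -/
lemma IsMidLogConcave.tilt_mul_le {n : ℕ} {w : EuclideanSpace ℝ (Fin n) → ℝ≥0∞}
    (hw : IsMidLogConcave w) {s R : ℝ} (hs : 0 ≤ s) (hR : 0 ≤ R) (θ : EuclideanSpace ℝ (Fin n))
    {A D B : Set (EuclideanSpace ℝ (Fin n))} (hA : MeasurableSet A) (hD : MeasurableSet D)
    (hB : MeasurableSet B) (hconv : Convex ℝ B) (hAB : A ⊆ B) (hDB : D ⊆ B)
    (hdist : ∀ a ∈ A, ∀ d ∈ D, R ≤ ‖a - d‖) :
    ENNReal.ofReal (exp (s * R ^ 2 / 4)) *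
      ((∫⁻ x in A, ENNReal.ofReal (exp (⟪θ, x⟫ - s * ‖x‖ ^ 2 / 2)) ∂(volume.withDensity w)) *
        ∫⁻ x in D, ENNReal.ofReal (exp (⟪θ, x⟫ - s * ‖x‖ ^ 2 / 2)) ∂(volume.withDensity w))
      ≤ (∫⁻ x in B, ENNReal.ofReal (exp (⟪θ, x⟫ - s * ‖x‖ ^ 2 / 2))
          ∂(volume.withDensity w)) ^ 2 := by
  have hm : Measurable fun x : EuclideanSpace ℝ (Fin n) =>
      ENNReal.ofReal (exp (⟪θ, x⟫ - s * ‖x‖ ^ 2 / 2)) := by fun_prop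
  rw [setLIntegral_withDensity_eq_setLIntegral_mul _ hw.measurable hm hA,
    setLIntegral_withDensity_eq_setLIntegral_mul _ hw.measurable hm hD,
    setLIntegral_withDensity_eq_setLIntegral_mul _ hw.measurable hm hB]
  refine setLIntegral_mul_le_of_midpoint (hw.measurable.mul hm) hA hD hB fun a ha d hd => ⟨?_, ?_⟩
  · rw [smul_add]
    exact hconv (hAB ha) (hDB hd) (by norm_num) (by norm_num) (by norm_num)
  · simp only [Pi.mul_apply]
    rw [mul_pow]
    have key : ENNReal.ofReal (exp (s * R ^ 2 / 4)) *
        (ENNReal.ofReal (exp (⟪θ, a⟫ - s * ‖a‖ ^ 2 / 2)) *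
          ENNReal.ofReal (exp (⟪θ, d⟫ - s * ‖d‖ ^ 2 / 2))) ≤
        ENNReal.ofReal (exp (⟪θ, (2⁻¹ : ℝ) • (a + d)⟫ - s * ‖(2⁻¹ : ℝ) • (a + d)‖ ^ 2 / 2)) ^ 2 := by
      rw [← ENNReal.ofReal_mul (by positivity), ← ENNReal.ofReal_mul (by positivity),
        ← ENNReal.ofReal_pow (by positivity), ← exp_add, ← exp_add, ← exp_nat_mul]
      refine ENNReal.ofReal_le_ofReal (exp_le_exp.2 ?_)
      have h1 : R ^ 2 ≤ ‖a - d‖ ^ 2 := by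
        have := hdist a ha d hd
        gcongr
      rw [norm_sub_sq_real] at h1
      rw [norm_smul, mul_pow, norm_add_sq_real, inner_smul_right, inner_add_right, norm_inv,
        Real.norm_ofNat]
      push_cast
      nlinarith
    calc _ = (w a * w d) * (ENNReal.ofReal (exp (s * R ^ 2 / 4)) *
          (ENNReal.ofReal (exp (⟪θ, a⟫ - s * ‖a‖ ^ 2 / 2)) *
            ENNReal.ofReal (exp (⟪θ, d⟫ - s * ‖d‖ ^ 2 / 2)))) := by ring
      _ ≤ _ := by
        gcongr
        exact hw.mul_le a d

open scoped ENNReal in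
lemma IsMidLogConcave.tail_mul_le {n : ℕ} {w : EuclideanSpace ℝ (Fin n) → ℝ≥0∞}
    (hw : IsMidLogConcave w) (u : EuclideanSpace ℝ (Fin n)) (a b : ℝ) :
    (volume.withDensity w) {x | a < ⟪u, x⟫} * (volume.withDensity w) {x | b < ⟪u, x⟫}
      ≤ (volume.withDensity w) {x | (a + b) / 2 < ⟪u, x⟫} ^ 2 := by
  have hm : ∀ c : ℝ, MeasurableSet {x : EuclideanSpace ℝ (Fin n) | c < ⟪u, x⟫} := fun c =>
    measurableSet_lt measurable_const (by fun_prop)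
  rw [withDensity_apply _ (hm _), withDensity_apply _ (hm _), withDensity_apply _ (hm _),
    ← one_mul (_ * _)]
  refine setLIntegral_mul_le_of_midpoint hw.measurable (hm _) (hm _) (hm _)
    fun x hx y hy => ⟨?_, ?_⟩
  · simp only [Set.mem_ofPred_eq, inner_smul_right, inner_add_right] at *
    linarith
  · rw [one_mul]
    exact hw.mul_le x y

lemma IsMidLogConcave.tail_le {n : ℕ} {w : EuclideanSpace ℝ (Fin n) → ENNReal}
    (hw : IsMidLogConcave w) [IsProbabilityMeasure (volume.withDensity w)]
    {u : EuclideanSpace ℝ (Fin n)}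
    (hu : ∫⁻ x, ENNReal.ofReal (⟪u, x⟫ ^ 2) ∂(volume.withDensity w) ≤ 1) (j : ℕ) :
    (volume.withDensity w).real {x | 2 + 4 * (j : ℝ) < ⟪u, x⟫} ≤ 1 / 4 * (1 / 3) ^ j := by
  set μ := volume.withDensity w
  set Q : ℝ → ℝ := fun t => μ.real {x | t < ⟪u, x⟫} with hQ
  have hm : ∀ c : ℝ, MeasurableSet {x : EuclideanSpace ℝ (Fin n) | c < ⟪u, x⟫} := fun c =>
    measurableSet_lt measurable_const (by fun_prop)
  have hQ0 : ∀ t, 0 ≤ Q t := fun t => measureReal_nonneg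
  have hQanti : ∀ s t, s ≤ t → Q t ≤ Q s := fun s t hst =>
    measureReal_mono fun x hx => lt_of_le_of_lt hst hx
  have hQmul : ∀ s t, Q s * Q t ≤ Q ((s + t) / 2) ^ 2 := by
    intro s t
    have := ENNReal.toReal_mono (by finiteness) (hw.tail_mul_le u s t)
    rwa [ENNReal.toReal_mul, ENNReal.toReal_pow] at this
  have hcheb : μ.real {x | 2 ≤ |⟪u, x⟫|} ≤ 1 / 4 := by
    have h1 := mul_meas_ge_le_lintegral (μ := μ)
      (f := fun x => ENNReal.ofReal (⟪u, x⟫ ^ 2)) (by fun_prop) 4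
    have h2 : {x : EuclideanSpace ℝ (Fin n) | 2 ≤ |⟪u, x⟫|} ⊆
        {x | (4 : ENNReal) ≤ ENNReal.ofReal (⟪u, x⟫ ^ 2)} := by
      intro x hx
      simp only [Set.mem_ofPred_eq] at *
      rw [← ENNReal.ofReal_ofNat]
      refine ENNReal.ofReal_le_ofReal ?_
      rw [← sq_abs]
      nlinarith
    have h3 : 4 * μ {x | 2 ≤ |⟪u, x⟫|} ≤ 1 :=
      ((mul_le_mul_right (measure_mono h2) _).trans h1).trans hu
    have h4 := ENNReal.toReal_mono (by simp) h3
    rw [ENNReal.toReal_mul] at h4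
    simp only [ENNReal.toReal_ofNat, ENNReal.toReal_one] at h4
    rw [measureReal_def]
    linarith
  have hQ2 : Q 2 ≤ 1 / 4 := by
    refine le_trans (measureReal_mono fun x hx => ?_) hcheb
    simp only [Set.mem_ofPred_eq] at *
    exact hx.le.trans (le_abs_self _)
  have hQm2 : 3 / 4 ≤ Q (-2) := by
    have h1 : Q (-2) = 1 - μ.real {x | -2 < ⟪u, x⟫}ᶜ := by
      rw [probReal_compl_eq_one_sub (hm _)]
      ring
    have h2 : μ.real {x | -2 < ⟪u, x⟫}ᶜ ≤ 1 / 4 := by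
      refine le_trans (measureReal_mono fun x hx => ?_) hcheb
      simp only [Set.mem_compl_iff, Set.mem_ofPred_eq, not_lt] at *
      rw [abs_of_nonpos (by linarith)]
      linarith
    linarith
  have step : ∀ j : ℕ, 3 * Q (2 + 4 * j) ≤ Q (-2 + 4 * j) := by
    intro j
    induction j with
    | zero => simp; linarith
    | succ j ih =>
      have e1 : (-2 + 4 * ((j + 1 : ℕ) : ℝ)) = 2 + 4 * j := by push_cast; ring
      rw [e1]
      have h1 := hQmul (-2 + 4 * j) (2 + 4 * (j + 1 : ℕ))
      have e2 : ((-2 + 4 * (j : ℝ)) + (2 + 4 * (j + 1 : ℕ))) / 2 = 2 + 4 * j := by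
        push_cast; ring
      rw [e2] at h1
      rcases (hQ0 (2 + 4 * j)).eq_or_lt with h0 | h0
      · have := hQanti (2 + 4 * j) (2 + 4 * (j + 1 : ℕ)) (by push_cast; linarith)
        rw [← h0] at this ⊢
        linarith
      · have := hQ0 (2 + 4 * (j + 1 : ℕ))
        nlinarith
  induction j with
  | zero => simpa using hQ2
  | succ j ih =>
    have h1 := step (j + 1)
    have e1 : (-2 + 4 * ((j + 1 : ℕ) : ℝ)) = 2 + 4 * j := by push_cast; ring
    rw [e1] at h1
    change Q (2 + 4 * (j + 1 : ℕ)) ≤ _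
    change Q (2 + 4 * j) ≤ _ at ih
    rw [pow_succ]
    linarith

/-- Linear functionals of unit variance have uniformly bounded exponential moments under a
logconcave measure. -/
lemma IsMidLogConcave.lintegral_exp_le {n : ℕ} {w : EuclideanSpace ℝ (Fin n) → ENNReal}
    (hw : IsMidLogConcave w) [IsProbabilityMeasure (volume.withDensity w)]
    {u : EuclideanSpace ℝ (Fin n)}
    (hu : ∫⁻ x, ENNReal.ofReal (⟪u, x⟫ ^ 2) ∂(volume.withDensity w) ≤ 1) :
    ∫⁻ x, ENNReal.ofReal (exp (⟪u, x⟫ / 8)) ∂(volume.withDensity w) ≤ 5 := by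
  set μ := volume.withDensity w
  have hm : ∀ c : ℝ, MeasurableSet {x : EuclideanSpace ℝ (Fin n) | c < ⟪u, x⟫} := fun c =>
    measurableSet_lt measurable_const (by fun_prop)
  have he : exp (1 / 2) ≤ 2 := by
    have h1 : exp (1 / 2) ^ 2 = exp 1 := by rw [← exp_nat_mul]; norm_num
    have := exp_one_lt_d9
    nlinarith [exp_pos (1 / 2)]
  have he' : exp (3 / 4) ≤ 3 := by
    refine (exp_le_exp.2 (by norm_num : (3 / 4 : ℝ) ≤ 1)).trans ?_
    linarith [exp_one_lt_d9]
  have hpt : ∀ x, ENNReal.ofReal (exp (⟪u, x⟫ / 8)) ≤ 2 + ∑' j : ℕ,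
      ({x | 2 + 4 * (j : ℝ) < ⟪u, x⟫} : Set (EuclideanSpace ℝ (Fin n))).indicator
        (fun _ => ENNReal.ofReal (3 * 2 ^ j)) x := by
    intro x
    rcases le_or_gt ⟪u, x⟫ 2 with h | h
    · refine le_add_right ?_
      refine ENNReal.ofReal_le_ofNat.2 (le_trans (exp_le_exp.2 ?_) he)
      linarith
    · refine le_add_left ?_
      obtain ⟨j, hj⟩ : ∃ j : ℕ, ⌈(⟪u, x⟫ - 2) / 4⌉₊ = j + 1 :=
        Nat.exists_eq_add_one.2 (Nat.ceil_pos.2 (by linarith))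
      rw [Nat.ceil_eq_iff (by omega)] at hj
      rw [Nat.add_sub_cancel] at hj
      push_cast at hj
      have hmem : x ∈ ({x | 2 + 4 * (j : ℝ) < ⟪u, x⟫} : Set (EuclideanSpace ℝ (Fin n))) := by
        have := hj.1
        simp only [Set.mem_ofPred_eq]
        linarith
      refine le_trans ?_ (ENNReal.le_tsum j)
      rw [Set.indicator_of_mem hmem]
      refine ENNReal.ofReal_le_ofReal ?_
      calc exp (⟪u, x⟫ / 8) ≤ exp (3 / 4 + j * (1 / 2)) := by
            rw [exp_le_exp]
            linarith [hj.2]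
        _ = exp (3 / 4) * exp (1 / 2) ^ j := by rw [exp_add, exp_nat_mul]
        _ ≤ _ := by gcongr
  calc _ ≤ ∫⁻ x, (2 + ∑' j : ℕ,
      ({x | 2 + 4 * (j : ℝ) < ⟪u, x⟫} : Set (EuclideanSpace ℝ (Fin n))).indicator
        (fun _ => ENNReal.ofReal (3 * 2 ^ j)) x) ∂μ := lintegral_mono hpt
    _ = 2 + ∑' j : ℕ, ENNReal.ofReal (3 * 2 ^ j) * μ {x | 2 + 4 * (j : ℝ) < ⟪u, x⟫} := by
      rw [lintegral_add_left measurable_const, lintegral_tsum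
        fun j => (measurable_const.indicator (hm _)).aemeasurable]
      simp [lintegral_indicator (hm _)]
    _ ≤ 2 + ∑' j : ℕ, ENNReal.ofReal (3 / 4 * (2 / 3) ^ j) := by
      gcongr with j
      rw [← ofReal_measureReal, ← ENNReal.ofReal_mul (by positivity)]
      refine ENNReal.ofReal_le_ofReal ?_
      calc (3 : ℝ) * 2 ^ j * μ.real {x | 2 + 4 * (j : ℝ) < ⟪u, x⟫}
          ≤ 3 * 2 ^ j * (1 / 4 * (1 / 3) ^ j) := by
            gcongr
            exact hw.tail_le hu j
        _ = 3 / 4 * (2 * (1 / 3)) ^ j := by rw [mul_pow]; ring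
        _ = _ := by norm_num
    _ ≤ 5 := by
      have hs := (summable_geometric_of_lt_one (r := (2 / 3 : ℝ)) (by norm_num)
        (by norm_num)).mul_left (3 / 4)
      rw [← ENNReal.ofReal_tsum_of_nonneg (fun j => by positivity) hs, tsum_mul_left,
        tsum_geometric_of_lt_one (by norm_num) (by norm_num), ← ENNReal.ofReal_ofNat,
        ← ENNReal.ofReal_add (by norm_num) (by norm_num), ← ENNReal.ofReal_ofNat]
      refine ENNReal.ofReal_le_ofReal ?_
      norm_num

/-- The directional second moments are at most those of an isotropic measure. -/
def IsSubIsotropic {n : ℕ} (μ : Measure (EuclideanSpace ℝ (Fin n))) : Prop :=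
  ∀ u, ∫⁻ x, ENNReal.ofReal (⟪u, x⟫ ^ 2) ∂μ ≤ ENNReal.ofReal (‖u‖ ^ 2)

lemma IsSubIsotropic.lintegral_norm_sq_le {n : ℕ} {μ : Measure (EuclideanSpace ℝ (Fin n))}
    (hμ : IsSubIsotropic μ) : ∫⁻ x, ENNReal.ofReal (‖x‖ ^ 2) ∂μ ≤ n := by
  have h1 : ∀ x : EuclideanSpace ℝ (Fin n), ENNReal.ofReal (‖x‖ ^ 2) =
      ∑ i, ENNReal.ofReal (⟪EuclideanSpace.single i (1 : ℝ), x⟫ ^ 2) := by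
    intro x
    rw [← ENNReal.ofReal_sum_of_nonneg fun i _ => by positivity, EuclideanSpace.norm_sq_eq]
    simp [EuclideanSpace.inner_single_left]
  simp_rw [h1]
  rw [lintegral_finsetSum _ fun i _ => by fun_prop]
  refine (Finset.sum_le_sum fun i _ => hμ _).trans ?_
  simp

lemma IsSubIsotropic.lintegral_norm_le {n : ℕ} (hn : 0 < n)
    {μ : Measure (EuclideanSpace ℝ (Fin n))} [IsProbabilityMeasure μ]
    (hμ : IsSubIsotropic μ) : ∫⁻ x, ENNReal.ofReal ‖x‖ ∂μ ≤ ENNReal.ofReal √n := by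
  have hq : 0 < √(n : ℝ) := by positivity
  have hsq : √(n : ℝ) ^ 2 = n := sq_sqrt (by positivity)
  calc ∫⁻ x, ENNReal.ofReal ‖x‖ ∂μ ≤ ∫⁻ x, (ENNReal.ofReal (1 / (2 * √n)) * ENNReal.ofReal (‖x‖ ^ 2) +
        ENNReal.ofReal (√n / 2)) ∂μ := by
        refine lintegral_mono fun x => ?_
        rw [← ENNReal.ofReal_mul (by positivity), ← ENNReal.ofReal_add (by positivity)
          (by positivity)]
        refine ENNReal.ofReal_le_ofReal ?_
        have : 1 / (2 * √n) * ‖x‖ ^ 2 + √n / 2 - ‖x‖ = (‖x‖ - √n) ^ 2 / (2 * √(n : ℝ)) := by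
          field_simp
          ring
        have h2 : 0 ≤ (‖x‖ - √n) ^ 2 / (2 * √(n : ℝ)) := by positivity
        linarith
    _ ≤ ENNReal.ofReal (1 / (2 * √n)) * ENNReal.ofReal n + ENNReal.ofReal (√n / 2) := by
        rw [lintegral_add_right _ measurable_const, lintegral_const_mul _ (by fun_prop)]
        simp only [lintegral_const, measure_univ, mul_one]
        gcongr
        rw [ENNReal.ofReal_natCast]
        exact hμ.lintegral_norm_sq_le
    _ = _ := by
        rw [← ENNReal.ofReal_mul (by positivity), ← ENNReal.ofReal_add (by positivity)
          (by positivity)]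
        congr 1
        field_simp
        linarith

lemma abs_exp_sub_one_le_abs_mul_exp_abs (t : ℝ) : |exp t - 1| ≤ |t| * exp |t| := by
  rcases le_total 0 t with ht | ht
  · rw [abs_of_nonneg ht, abs_of_nonneg (by linarith [one_le_exp ht])]
    have h1 := add_one_le_exp (-t)
    have h2 : exp (-t) * exp t = 1 := by rw [← exp_add]; simp
    nlinarith [exp_pos t]
  · rw [abs_of_nonpos ht, abs_of_nonpos (by linarith [exp_le_one_iff.2 ht])]
    have h1 := add_one_le_exp t
    have h2 := one_le_exp (neg_nonneg.2 ht)
    nlinarith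

lemma lintegral_abs_exp_sub_one_le {n : ℕ} {w : EuclideanSpace ℝ (Fin n) → ENNReal}
    (hw : IsMidLogConcave w) [IsProbabilityMeasure (volume.withDensity w)]
    (hμ : IsSubIsotropic (volume.withDensity w)) (v : EuclideanSpace ℝ (Fin n))
    (hv : ‖v‖ ≤ 1 / 16) :
    ∫⁻ x, ENNReal.ofReal |exp ⟪v, x⟫ - 1| ∂(volume.withDensity w) ≤ ENNReal.ofReal (160 * ‖v‖) := by
  rcases eq_or_ne v 0 with rfl | hv0
  · simp
  have hvp : 0 < ‖v‖ := norm_pos_iff.2 hv0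
  set u := ‖v‖⁻¹ • v with hu
  have hun : ‖u‖ = 1 := by rw [hu, norm_smul, norm_inv, norm_norm, inv_mul_cancel₀ hvp.ne']
  have hvu : v = ‖v‖ • u := by rw [hu, smul_smul, mul_inv_cancel₀ hvp.ne', one_smul]
  have e1 := hw.lintegral_exp_le (u := u) ((hμ u).trans (by simp [hun]))
  have e2 := hw.lintegral_exp_le (u := -u) ((hμ (-u)).trans (by simp [hun]))
  calc _ ≤ ∫⁻ x, ENNReal.ofReal (16 * ‖v‖) * (ENNReal.ofReal (exp (⟪u, x⟫ / 8)) +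
        ENNReal.ofReal (exp (⟪-u, x⟫ / 8))) ∂(volume.withDensity w) := by
        refine lintegral_mono fun x => ?_
        rw [← ENNReal.ofReal_add (by positivity) (by positivity),
          ← ENNReal.ofReal_mul (by positivity)]
        refine ENNReal.ofReal_le_ofReal ?_
        set z := ⟪u, x⟫ with hz
        have h1 : ⟪v, x⟫ = ‖v‖ * z := by
          rw [hvu, inner_smul_left, ← hvu]
          simp [hz]
        rw [h1, inner_neg_left, ← hz]
        have h2 : |exp (‖v‖ * z) - 1| ≤ |‖v‖ * z| * exp |‖v‖ * z| := by
          exact abs_exp_sub_one_le_abs_mul_exp_abs _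
        rw [abs_mul, abs_of_pos hvp] at h2
        have h3 : |z| ≤ 16 * exp (|z| / 16) := by
          have := add_one_le_exp (|z| / 16)
          linarith
        have h4 : exp (‖v‖ * |z|) ≤ exp (|z| / 16) := by
          rw [exp_le_exp]
          nlinarith [abs_nonneg z]
        have h5 : exp (|z| / 16) * exp (|z| / 16) ≤ exp (z / 8) + exp (-z / 8) := by
          rw [← exp_add]
          rcases abs_cases z with ⟨h, -⟩ | ⟨h, -⟩ <;> rw [h]
          · have : z / 16 + z / 16 = z / 8 := by ring
            rw [this]
            linarith [exp_pos (-z / 8)]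
          · have : -z / 16 + -z / 16 = -z / 8 := by ring
            rw [this]
            linarith [exp_pos (z / 8)]
        calc _ ≤ ‖v‖ * |z| * exp (‖v‖ * |z|) := h2
          _ ≤ ‖v‖ * (16 * exp (|z| / 16)) * exp (|z| / 16) := by gcongr
          _ = 16 * ‖v‖ * (exp (|z| / 16) * exp (|z| / 16)) := by ring
          _ ≤ _ := by gcongr
    _ ≤ ENNReal.ofReal (16 * ‖v‖) * (5 + 5) := by
        rw [lintegral_const_mul _ (by fun_prop), lintegral_add_left (by fun_prop)]
        gcongr
    _ = _ := by
        rw [show (5 + 5 : ENNReal) = ENNReal.ofReal 10 by norm_num,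
          ← ENNReal.ofReal_mul (by positivity)]
        congr 1
        ring

/-! ### Gaussian randomization of the tilt -/

open ProbabilityTheory in
lemma lintegral_exp_inner_stdGaussian {n : ℕ} (v : EuclideanSpace ℝ (Fin n)) :
    ∫⁻ θ, ENNReal.ofReal (exp ⟪θ, v⟫) ∂(stdGaussian (EuclideanSpace ℝ (Fin n)))
      = ENNReal.ofReal (exp (‖v‖ ^ 2 / 2)) := by
  set γ := stdGaussian (EuclideanSpace ℝ (Fin n))
  have h1 : γ.map (innerSL ℝ v) = gaussianReal 0 (‖v‖ ^ 2).toNNReal := by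
    rw [IsGaussian.map_eq_gaussianReal, integral_strongDual_stdGaussian,
      variance_dual_stdGaussian, innerSL_apply_norm]
  have h2 : ∫⁻ θ, ENNReal.ofReal (exp ⟪θ, v⟫) ∂γ
      = ∫⁻ t, ENNReal.ofReal (exp t) ∂(γ.map (innerSL ℝ v)) := by
    rw [lintegral_map (by fun_prop) (by fun_prop)]
    simp [real_inner_comm]
  have h3 := congrFun (mgf_id_gaussianReal (μ := 0) (v := (‖v‖ ^ 2).toNNReal)) 1
  have h4 := integrable_exp_mul_gaussianReal (μ := 0) (v := (‖v‖ ^ 2).toNNReal) 1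
  simp only [one_mul, mgf, id] at h3 h4
  rw [h2, h1, ← ofReal_integral_eq_lintegral_ofReal h4 (ae_of_all _ fun x => by positivity), h3]
  simp

/-- The mass of the Gaussian tilt of `ν` by `√s • θ`. -/
noncomputable def tiltMass {n : ℕ} (ν : Measure (EuclideanSpace ℝ (Fin n))) (s : ℝ)
    (θ : EuclideanSpace ℝ (Fin n)) : ENNReal :=
  ∫⁻ x, ENNReal.ofReal (exp (⟪√s • θ, x⟫ - s * ‖x‖ ^ 2 / 2)) ∂ν

lemma measurable_tiltMass {n : ℕ} (ν : Measure (EuclideanSpace ℝ (Fin n))) [SFinite ν] (s : ℝ) :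
    Measurable (tiltMass ν s) :=
  Measurable.lintegral_prod_right' (f := fun p : EuclideanSpace ℝ (Fin n) ×
    EuclideanSpace ℝ (Fin n) => ENNReal.ofReal (exp (⟪√s • p.1, p.2⟫ - s * ‖p.2‖ ^ 2 / 2)))
    (by fun_prop)

open ProbabilityTheory in
lemma lintegral_tiltMass {n : ℕ} (ν : Measure (EuclideanSpace ℝ (Fin n))) [SFinite ν] {s : ℝ}
    (hs : 0 ≤ s) :
    ∫⁻ θ, tiltMass ν s θ ∂(stdGaussian (EuclideanSpace ℝ (Fin n))) = ν Set.univ := by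
  unfold tiltMass
  rw [lintegral_lintegral_swap (by fun_prop), ← lintegral_one]
  refine lintegral_congr fun x => ?_
  have h1 : ∀ θ : EuclideanSpace ℝ (Fin n),
      ENNReal.ofReal (exp (⟪√s • θ, x⟫ - s * ‖x‖ ^ 2 / 2)) =
        ENNReal.ofReal (exp ⟪θ, √s • x⟫) * ENNReal.ofReal (exp (-(s * ‖x‖ ^ 2 / 2))) := by
    intro θ
    rw [← ENNReal.ofReal_mul (by positivity), ← exp_add, inner_smul_left, inner_smul_right,
      conj_trivial, sub_eq_add_neg]
  simp_rw [h1]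
  rw [lintegral_mul_const _ (by fun_prop), lintegral_exp_inner_stdGaussian,
    ← ENNReal.ofReal_mul (by positivity), ← exp_add, norm_smul, mul_pow, Real.norm_eq_abs, sq_abs,
    sq_sqrt hs]
  simp

open ProbabilityTheory in
lemma lintegral_tiltMass_sq {n : ℕ} (ν : Measure (EuclideanSpace ℝ (Fin n))) [SFinite ν] {s : ℝ}
    (hs : 0 ≤ s) :
    ∫⁻ θ, tiltMass ν s θ ^ 2 ∂(stdGaussian (EuclideanSpace ℝ (Fin n))) =
      ∫⁻ y, ∫⁻ x, ENNReal.ofReal (exp (s * ⟪y, x⟫)) ∂ν ∂ν := by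
  have h1 : ∀ θ, tiltMass ν s θ ^ 2 = ∫⁻ y, ∫⁻ x,
      ENNReal.ofReal (exp ⟪θ, √s • (y + x)⟫) *
        ENNReal.ofReal (exp (-(s * (‖y‖ ^ 2 + ‖x‖ ^ 2) / 2))) ∂ν ∂ν := by
    intro θ
    rw [sq, tiltMass, ← lintegral_mul_const _ (by fun_prop)]
    refine lintegral_congr fun y => ?_
    rw [← lintegral_const_mul _ (by fun_prop)]
    refine lintegral_congr fun x => ?_
    rw [← ENNReal.ofReal_mul (by positivity), ← ENNReal.ofReal_mul (by positivity), ← exp_add,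
      ← exp_add]
    simp only [inner_smul_left, inner_smul_right, inner_add_right, conj_trivial]
    ring_nf
  simp_rw [h1]
  rw [lintegral_lintegral_swap]
  swap
  · exact (Measurable.lintegral_prod_right' (f := fun p : (EuclideanSpace ℝ (Fin n) ×
      EuclideanSpace ℝ (Fin n)) × EuclideanSpace ℝ (Fin n) =>
        ENNReal.ofReal (exp ⟪p.1.1, √s • (p.1.2 + p.2)⟫) *
        ENNReal.ofReal (exp (-(s * (‖p.1.2‖ ^ 2 + ‖p.2‖ ^ 2) / 2)))) (by fun_prop)).aemeasurable
  refine lintegral_congr fun y => ?_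
  rw [lintegral_lintegral_swap (by fun_prop)]
  refine lintegral_congr fun x => ?_
  rw [lintegral_mul_const _ (by fun_prop), lintegral_exp_inner_stdGaussian,
    ← ENNReal.ofReal_mul (by positivity), ← exp_add, norm_smul, mul_pow, Real.norm_eq_abs, sq_abs,
    sq_sqrt hs, norm_add_sq_real]
  ring_nf

open ProbabilityTheory in
/-- The mass of the random Gaussian tilt of `ν` has small variance as soon as `s * ⟪x, y⟫` is small
on average. -/
lemma lintegral_tiltMass_sub_sq_le {n : ℕ} (ν : Measure (EuclideanSpace ℝ (Fin n)))
    [IsFiniteMeasure ν] {s : ℝ} (hs : 0 ≤ s) :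
    ∫⁻ θ, ENNReal.ofReal (((tiltMass ν s θ).toReal - ν.real Set.univ) ^ 2)
        ∂(stdGaussian (EuclideanSpace ℝ (Fin n))) ≤
      ∫⁻ y, ∫⁻ x, ENNReal.ofReal |exp (s * ⟪y, x⟫) - 1| ∂ν ∂ν := by
  set γ := stdGaussian (EuclideanSpace ℝ (Fin n))
  have hZ := measurable_tiltMass ν s
  have hmean := lintegral_tiltMass ν hs
  have hfin : ∀ᵐ θ ∂γ, tiltMass ν s θ < ⊤ := ae_lt_top hZ (by rw [hmean]; finiteness)
  have hsq : ∫⁻ θ, tiltMass ν s θ ^ 2 ∂γ ≤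
      (∫⁻ y, ∫⁻ x, ENNReal.ofReal |exp (s * ⟪y, x⟫) - 1| ∂ν ∂ν) + ν Set.univ ^ 2 := by
    rw [lintegral_tiltMass_sq ν hs, sq, ← lintegral_const (μ := ν),
      ← lintegral_add_right _ measurable_const]
    refine lintegral_mono fun y => ?_
    rw [← one_mul (ν Set.univ), ← lintegral_const (μ := ν),
      ← lintegral_add_right _ measurable_const]
    refine lintegral_mono fun x => ?_
    rw [← ENNReal.ofReal_one, ← ENNReal.ofReal_add (by positivity) (by norm_num)]
    refine ENNReal.ofReal_le_ofReal ?_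
    linarith [le_abs_self (exp (s * ⟪y, x⟫) - 1)]
  have hexp : (∫⁻ θ, ENNReal.ofReal (((tiltMass ν s θ).toReal - ν.real Set.univ) ^ 2) ∂γ) +
      2 * ν Set.univ * ν Set.univ = (∫⁻ θ, tiltMass ν s θ ^ 2 ∂γ) + ν Set.univ ^ 2 := by
    nth_rewrite 2 [← hmean]
    rw [← lintegral_const_mul _ hZ, ← lintegral_add_right _ (by fun_prop)]
    have : ν Set.univ ^ 2 = ∫⁻ _, ν Set.univ ^ 2 ∂γ := by simp
    rw [this, ← lintegral_add_right _ measurable_const]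
    refine lintegral_congr_ae ?_
    filter_upwards [hfin] with θ hθ
    have ha : ν Set.univ ≠ ⊤ := by finiteness
    rw [measureReal_def]
    lift tiltMass ν s θ to NNReal using hθ.ne with z
    lift ν Set.univ to NNReal using ha with a
    simp only [ENNReal.coe_toReal]
    rw [← ENNReal.ofReal_coe_nnreal (p := z), ← ENNReal.ofReal_coe_nnreal (p := a),
      ← ENNReal.ofReal_ofNat, ← ENNReal.ofReal_mul (by positivity),
      ← ENNReal.ofReal_mul (by positivity), ← ENNReal.ofReal_add (by positivity) (by positivity),
      ← ENNReal.ofReal_pow (by positivity), ← ENNReal.ofReal_pow (by positivity),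
      ← ENNReal.ofReal_add (by positivity) (by positivity)]
    congr 1
    ring
  have h2 : 2 * ν Set.univ * ν Set.univ ≠ ⊤ := by finiteness
  refine (ENNReal.add_le_add_iff_right h2).1 ?_
  rw [hexp]
  calc _ ≤ _ := add_le_add_left hsq _
    _ = _ := by ring

/-! ### Tail bounds -/

lemma lintegral_lintegral_abs_exp_le {n : ℕ} (hn : 0 < n) {w : EuclideanSpace ℝ (Fin n) → ENNReal}
    (hw : IsMidLogConcave w) [IsProbabilityMeasure (volume.withDensity w)]
    (hμ : IsSubIsotropic (volume.withDensity w)) {s : ℝ} (hs : 0 < s)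
    {S : Set (EuclideanSpace ℝ (Fin n))} (hSm : MeasurableSet S)
    (hS : S ⊆ Metric.closedBall 0 (1 / (16 * s))) :
    ∫⁻ y in S, ∫⁻ x in S, ENNReal.ofReal |exp (s * ⟪y, x⟫) - 1| ∂(volume.withDensity w)
      ∂(volume.withDensity w) ≤ ENNReal.ofReal (160 * (s * √n)) := by
  set μ := volume.withDensity w
  calc _ ≤ ∫⁻ y in S, ENNReal.ofReal (160 * s) * ENNReal.ofReal ‖y‖ ∂μ := by
        refine setLIntegral_mono' hSm fun y hy => ?_
        refine (setLIntegral_le_lintegral _ _).trans ?_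
        have hy' : ‖y‖ ≤ 1 / (16 * s) := by simpa using hS hy
        have hn : ‖s • y‖ = s * ‖y‖ := by rw [norm_smul, Real.norm_of_nonneg hs.le]
        have := lintegral_abs_exp_sub_one_le hw hμ (s • y) (by
          rw [hn]
          calc s * ‖y‖ ≤ s * (1 / (16 * s)) := by gcongr
            _ = 1 / 16 := by field_simp)
        simp only [inner_smul_left, conj_trivial] at this
        refine this.trans_eq ?_
        rw [hn, ← ENNReal.ofReal_mul (by positivity), mul_assoc]
    _ ≤ ENNReal.ofReal (160 * s) * ENNReal.ofReal √n := by
        rw [lintegral_const_mul _ (by fun_prop)]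
        gcongr
        exact (setLIntegral_le_lintegral _ _).trans (hμ.lintegral_norm_le hn)
    _ = _ := by rw [← ENNReal.ofReal_mul (by positivity), mul_assoc]

lemma IsSubIsotropic.measureReal_compl_closedBall_le {n : ℕ}
    {μ : Measure (EuclideanSpace ℝ (Fin n))} [IsProbabilityMeasure μ] (hμ : IsSubIsotropic μ)
    {s : ℝ} (hs : 0 < s) :
    μ.real (Metric.closedBall 0 (1 / (16 * s)))ᶜ ≤ 256 * (s * √n) ^ 2 := by
  have h1 := (mul_meas_ge_le_lintegral (μ := μ)
    (f := fun x => ENNReal.ofReal (‖x‖ ^ 2)) (by fun_prop)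
      (ENNReal.ofReal ((1 / (16 * s)) ^ 2))).trans hμ.lintegral_norm_sq_le
  have h2 : (Metric.closedBall (0 : EuclideanSpace ℝ (Fin n)) (1 / (16 * s)))ᶜ ⊆
      {x | ENNReal.ofReal ((1 / (16 * s)) ^ 2) ≤ ENNReal.ofReal (‖x‖ ^ 2)} := by
    intro x hx
    simp only [Set.mem_compl_iff, Metric.mem_closedBall, dist_zero_right, not_le] at hx
    simp only [Set.mem_ofPred_eq]
    gcongr
  have h3 := ENNReal.toReal_mono (by finiteness)
    ((mul_le_mul_right (measure_mono h2) _).trans h1)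
  rw [ENNReal.toReal_mul, ENNReal.toReal_ofReal (by positivity), ENNReal.toReal_natCast] at h3
  rw [measureReal_def, mul_pow, sq_sqrt (by positivity)]
  calc _ = (256 * s ^ 2) * ((1 / (16 * s)) ^ 2 *
        (μ (Metric.closedBall 0 (1 / (16 * s)))ᶜ).toReal) := by
        generalize (μ (Metric.closedBall 0 (1 / (16 * s)))ᶜ).toReal = t
        field_simp
        norm_num
    _ ≤ (256 * s ^ 2) * n := by gcongr
    _ = _ := by ring

lemma le_of_tilt_mass_bounds {zA zB zD a b e : ℝ} (ha : 1 / 4 ≤ a) (hb : b ≤ 1)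
    (hzD : 0 ≤ zD) (he : 0 ≤ e) (hDB : zD ≤ zB) (h : zA * zD ≤ e * zB ^ 2) :
    zD ≤ 32 * e + (128 * (zA - a) ^ 2 + 2 * (zB - b) ^ 2) := by
  rcases le_or_gt zB 2 with h2 | h2
  · rcases le_or_gt (a / 2) zA with h3 | h3
    · have h4 : zA * zD ≤ e * 4 := h.trans (by gcongr; nlinarith)
      nlinarith [sq_nonneg (zA - a), sq_nonneg (zB - b)]
    · have : 1 / 8 ≤ a - zA := by linarith
      nlinarith [sq_nonneg (zB - b)]
  · nlinarith [sq_nonneg (zA - a)]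

open ProbabilityTheory in
/-- A set at distance `R` from a set of measure at least `1 / 2` has small measure: after a random
Gaussian tilt of variance `s`, the measure becomes `s`-strongly logconcave, while the measure of the
large set hardly changes. -/
lemma measureReal_le_of_dist_le {n : ℕ} (hn : 0 < n) {w : EuclideanSpace ℝ (Fin n) → ENNReal}
    (hw : IsMidLogConcave w) [IsProbabilityMeasure (volume.withDensity w)]
    (hμ : IsSubIsotropic (volume.withDensity w)) {s R : ℝ} (hs : 0 < s) (hsn : s * √n ≤ 1 / 32)
    (hR : 0 ≤ R) {A D : Set (EuclideanSpace ℝ (Fin n))} (hA : MeasurableSet A)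
    (hD : MeasurableSet D) (hdist : ∀ a ∈ A, ∀ d ∈ D, R ≤ ‖a - d‖)
    (hA2 : 1 / 2 ≤ (volume.withDensity w).real A) :
    (volume.withDensity w).real D ≤
      32 * exp (-(s * R ^ 2 / 4)) + 20800 * (s * √n) + 256 * (s * √n) ^ 2 := by
  set μ := volume.withDensity w
  set γ := stdGaussian (EuclideanSpace ℝ (Fin n))
  set B := Metric.closedBall (0 : EuclideanSpace ℝ (Fin n)) (1 / (16 * s))
  have hB : MeasurableSet B := measurableSet_closedBall
  have hBc : μ.real Bᶜ ≤ 256 * (s * √n) ^ 2 := hμ.measureReal_compl_closedBall_le hs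
  have hsplit : ∀ S : Set (EuclideanSpace ℝ (Fin n)), μ.real S ≤ μ.real (S ∩ B) + μ.real Bᶜ := by
    intro S
    refine (measureReal_mono (s₂ := (S ∩ B) ∪ Bᶜ) fun x hx => ?_).trans (measureReal_union_le _ _)
    by_cases hxB : x ∈ B <;> simp [hx, hxB]
  have hAB : 1 / 4 ≤ μ.real (A ∩ B) := by
    have h0 : 0 ≤ s * √n := by positivity
    nlinarith [hsplit A]
  set zA := fun θ => (tiltMass (μ.restrict (A ∩ B)) s θ).toReal
  set zB := fun θ => (tiltMass (μ.restrict B) s θ).toReal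
  have hmA := measurable_tiltMass (μ.restrict (A ∩ B)) s
  have hmB := measurable_tiltMass (μ.restrict B) s
  have hvar : ∀ S, MeasurableSet S → S ⊆ B →
      ∫⁻ θ, ENNReal.ofReal (((tiltMass (μ.restrict S) s θ).toReal - μ.real S) ^ 2) ∂γ ≤
        ENNReal.ofReal (160 * (s * √n)) := by
    intro S hSm hS
    have := lintegral_tiltMass_sub_sq_le (μ.restrict S) hs.le
    rw [measureReal_restrict_apply_univ] at this
    exact this.trans (lintegral_lintegral_abs_exp_le hn hw hμ hs hSm hS)
  have hpt : ∀ᵐ θ ∂γ, tiltMass (μ.restrict (D ∩ B)) s θ ≤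
      ENNReal.ofReal (32 * exp (-(s * R ^ 2 / 4))) +
        (ENNReal.ofReal 128 * ENNReal.ofReal ((zA θ - μ.real (A ∩ B)) ^ 2) +
          ENNReal.ofReal 2 * ENNReal.ofReal ((zB θ - μ.real B) ^ 2)) := by
    have hfin : ∀ᵐ θ ∂γ, tiltMass (μ.restrict B) s θ < ⊤ :=
      ae_lt_top hmB (by rw [lintegral_tiltMass _ hs.le]; finiteness)
    filter_upwards [hfin] with θ hθ
    have hmono : ∀ S, S ⊆ B → tiltMass (μ.restrict S) s θ ≤ tiltMass (μ.restrict B) s θ :=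
      fun S hS => lintegral_mono_set hS
    have hDB := hmono (D ∩ B) Set.inter_subset_right
    have hDfin := hDB.trans_lt hθ
    have key := hw.tilt_mul_le hs.le hR (√s • θ) (hA.inter hB) (hD.inter hB) hB
      (convex_closedBall _ _) Set.inter_subset_right Set.inter_subset_right
      fun a ha d hd => hdist a ha.1 d hd.1
    have key' := ENNReal.toReal_mono (ENNReal.pow_ne_top hθ.ne) key
    rw [ENNReal.toReal_mul, ENNReal.toReal_mul, ENNReal.toReal_pow,
      ENNReal.toReal_ofReal (by positivity)] at key'
    rw [← ENNReal.ofReal_toReal hDfin.ne, ← ENNReal.ofReal_mul (by norm_num),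
      ← ENNReal.ofReal_mul (by norm_num), ← ENNReal.ofReal_add (by positivity) (by positivity),
      ← ENNReal.ofReal_add (by positivity) (by positivity)]
    refine ENNReal.ofReal_le_ofReal (le_of_tilt_mass_bounds hAB measureReal_le_one
      ENNReal.toReal_nonneg (exp_pos _).le (ENNReal.toReal_mono hθ.ne hDB) ?_)
    rw [exp_neg, ← div_eq_inv_mul, le_div_iff₀' (exp_pos _)]
    exact key'
  have hint : μ (D ∩ B) ≤ ENNReal.ofReal (32 * exp (-(s * R ^ 2 / 4)) + 20800 * (s * √n)) := by
    calc μ (D ∩ B) = ∫⁻ θ, tiltMass (μ.restrict (D ∩ B)) s θ ∂γ := by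
          rw [lintegral_tiltMass _ hs.le, Measure.restrict_apply_univ]
      _ ≤ _ := lintegral_mono_ae hpt
      _ ≤ ENNReal.ofReal (32 * exp (-(s * R ^ 2 / 4))) +
          (ENNReal.ofReal 128 * ENNReal.ofReal (160 * (s * √n)) +
            ENNReal.ofReal 2 * ENNReal.ofReal (160 * (s * √n))) := by
          rw [lintegral_add_left measurable_const, lintegral_add_left (by fun_prop),
            lintegral_const_mul _ (by fun_prop), lintegral_const_mul _ (by fun_prop)]
          simp only [lintegral_const, measure_univ, mul_one]
          gcongr
          · exact hvar _ (hA.inter hB) Set.inter_subset_right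
          · exact hvar _ hB subset_rfl
      _ = _ := by
          rw [← ENNReal.ofReal_mul (by norm_num), ← ENNReal.ofReal_mul (by norm_num),
            ← ENNReal.ofReal_add (by positivity) (by positivity),
            ← ENNReal.ofReal_add (by positivity) (by positivity)]
          congr 1
          ring
  have hint' := ENNReal.toReal_le_of_le_ofReal (by positivity) hint
  rw [← measureReal_def] at hint'
  linarith [hsplit D]

/-- Lipschitz functions deviate upwards from a median at scale `n ^ (1 / 4)`, with a polynomial
tail. -/
lemma measureReal_lipschitz_tail_le {n : ℕ} (hn : 0 < n)
    {w : EuclideanSpace ℝ (Fin n) → ENNReal} (hw : IsMidLogConcave w)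
    [IsProbabilityMeasure (volume.withDensity w)] (hμ : IsSubIsotropic (volume.withDensity w))
    {L : ℝ} (hL : 0 < L) {g : EuclideanSpace ℝ (Fin n) → ℝ} (hg : Measurable g)
    (hlip : ∀ x y, |g x - g y| ≤ L * ‖x - y‖) {m : ℝ}
    (hm : 1 / 2 ≤ (volume.withDensity w).real {x | g x ≤ m}) {k : ℝ} (hk : 1 ≤ k) :
    (volume.withDensity w).real {x | k * (L * (n : ℝ) ^ ((1 : ℝ) / 4)) < g x - m} ≤
      500000000 * k ^ (-(3 / 2) : ℝ) := by
  set q := (n : ℝ) ^ ((1 : ℝ) / 4) with hq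
  have hq0 : 0 < q := by positivity
  have hq2 : √(n : ℝ) = q ^ 2 := by
    rw [hq, ← rpow_natCast, ← rpow_mul (by positivity), sqrt_eq_rpow]
    norm_num
  have hk0 : 0 < k := by linarith
  set τ := k ^ (-(3 / 2) : ℝ) with hτ
  have hτ0 : 0 < τ := by positivity
  have hτ1 : τ ≤ 1 := rpow_le_one_of_one_le_of_nonpos hk (by norm_num)
  have hsn : τ / (32 * q ^ 2) * √n = τ / 32 := by
    rw [hq2]
    field_simp
  have key := measureReal_le_of_dist_le hn hw hμ (s := τ / (32 * q ^ 2)) (R := k * q)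
    (A := {x | g x ≤ m}) (D := {x | k * (L * q) < g x - m}) (by positivity)
    (by rw [hsn]; linarith) (by positivity) (measurableSet_le hg measurable_const)
    (measurableSet_lt measurable_const (by fun_prop))
    (fun a ha d hd => by
      simp only [Set.mem_ofPred_eq] at ha hd
      have h1 := (neg_abs_le _).trans (neg_le_neg (le_refl |g a - g d|)) |>.trans
        (neg_le_neg (neg_le_abs (g a - g d)))
      have h2 := (neg_le_abs (g a - g d)).trans (hlip a d)
      refine le_of_mul_le_mul_left (a := L) ?_ hL
      linarith) hm
  rw [hsn] at key
  refine key.trans ?_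
  set r := √k with hr
  have hr0 : 0 < r := by positivity
  have hr2 : r ^ 2 = k := sq_sqrt hk0.le
  have hτr : τ = 1 / r ^ 3 := by
    rw [hτ, rpow_neg hk0.le, one_div, hr, sqrt_eq_rpow, ← rpow_natCast, ← rpow_mul hk0.le]
    norm_num
  have he : τ / (32 * q ^ 2) * (k * q) ^ 2 / 4 = r / 128 := by
    rw [hτr, ← hr2]
    field_simp
    norm_num
  have hexp : exp (-(r / 128)) ≤ 6 * 128 ^ 3 * τ := by
    have h1 := pow_div_factorial_le_exp (r / 128) (by positivity) 3
    rw [exp_neg, hτr]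
    rw [inv_le_comm₀ (exp_pos _) (by positivity)]
    refine le_trans (le_of_eq ?_) h1
    simp [Nat.factorial]
    field_simp
  rw [he]
  nlinarith

lemma lintegral_ofReal_le_of_tail {α : Type*} [MeasurableSpace α] {μ : Measure α}
    [IsProbabilityMeasure μ] {f : α → ℝ} (hf : Measurable f) {b K : ℝ} (hb : 0 < b) (hK : 0 ≤ K)
    (h : ∀ k : ℝ, 1 ≤ k → μ.real {x | k * b < f x} ≤ K * k ^ (-(3 / 2) : ℝ)) :
    ∫⁻ x, ENNReal.ofReal (f x) ∂μ ≤ ENNReal.ofReal ((1 + 2 * K) * b) := by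
  have h1 : ∀ x, ENNReal.ofReal (f x) = ENNReal.ofReal b * ENNReal.ofReal (max (f x / b) 0) := by
    intro x
    rw [← ENNReal.ofReal_mul hb.le, mul_max_of_nonneg _ _ hb.le, mul_div_cancel₀ _ hb.ne', mul_zero]
    rcases le_total (f x) 0 with hx | hx
    · rw [max_eq_right hx, ENNReal.ofReal_of_nonpos hx, ENNReal.ofReal_zero]
    · rw [max_eq_left hx]
  simp_rw [h1]
  have hint := integrableOn_Ioi_rpow_of_lt (a := -(3 / 2)) (by norm_num) zero_lt_one
  rw [lintegral_const_mul _ (by fun_prop), mul_comm, ENNReal.ofReal_mul (by positivity)]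
  gcongr
  rw [lintegral_eq_lintegral_meas_lt (f := fun x => max (f x / b) 0) μ
      (ae_of_all _ fun x => le_max_right _ _) (by fun_prop),
    ← Set.Ioc_union_Ioi_eq_Ioi (zero_le_one' ℝ), lintegral_union measurableSet_Ioi
      (Set.disjoint_left.2 fun x hx hx' => not_lt.2 hx.2 hx'),
    ENNReal.ofReal_add (by norm_num) (by positivity)]
  gcongr
  · calc _ ≤ ∫⁻ t in Set.Ioc (0 : ℝ) 1, 1 := lintegral_mono fun t => prob_le_one
      _ = _ := by simp
  · calc _ ≤ ∫⁻ t in Set.Ioi (1 : ℝ), ENNReal.ofReal (K * t ^ (-(3 / 2) : ℝ)) := by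
          refine setLIntegral_mono' measurableSet_Ioi fun t ht => ?_
          have ht' : (1 : ℝ) < t := ht
          rw [ENNReal.le_ofReal_iff_toReal_le (by finiteness) (by positivity), ← measureReal_def]
          refine le_trans (measureReal_mono fun x hx => ?_) (h t ht'.le)
          simp only [Set.mem_ofPred_eq, lt_max_iff] at *
          rcases hx with hx | hx
          · exact (lt_div_iff₀ hb).1 hx
          · linarith
      _ = ENNReal.ofReal (∫ t in Set.Ioi (1 : ℝ), K * t ^ (-(3 / 2) : ℝ)) := by
          rw [ofReal_integral_eq_lintegral_ofReal (hint.const_mul K)]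
          filter_upwards [ae_restrict_mem measurableSet_Ioi] with t ht
          have ht' : (1 : ℝ) < t := ht
          have : 0 < t := by linarith
          positivity
      _ ≤ _ := by
          refine ENNReal.ofReal_le_ofReal ?_
          rw [integral_const_mul, integral_Ioi_rpow_of_lt (by norm_num) zero_lt_one]
          norm_num
          linarith

/-- The mean and the median of a Lipschitz function under an isotropic logconcave measure. -/
lemma abs_integral_sub_median_le {n : ℕ} (hn : 0 < n)
    {w : EuclideanSpace ℝ (Fin n) → ENNReal} (hw : IsMidLogConcave w)
    [IsProbabilityMeasure (volume.withDensity w)] (hμ : IsSubIsotropic (volume.withDensity w))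
    {L : ℝ} (hL : 0 < L) {g : EuclideanSpace ℝ (Fin n) → ℝ} (hg : Measurable g)
    (hlip : ∀ x y, |g x - g y| ≤ L * ‖x - y‖) {m : ℝ}
    (hm : 1 / 2 ≤ (volume.withDensity w).real {x | g x ≤ m})
    (hm' : 1 / 2 ≤ (volume.withDensity w).real {x | m ≤ g x}) :
    |(∫ x, g x ∂(volume.withDensity w)) - m| ≤
      2000000002 * L * (n : ℝ) ^ ((1 : ℝ) / 4) := by
  set μ := volume.withDensity w
  have hb : 0 < L * (n : ℝ) ^ ((1 : ℝ) / 4) := by positivity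
  have h1 : ∫⁻ x, ENNReal.ofReal (g x - m) ∂μ ≤
      ENNReal.ofReal ((1 + 2 * 500000000) * (L * (n : ℝ) ^ ((1 : ℝ) / 4))) :=
    lintegral_ofReal_le_of_tail (by fun_prop) hb (by norm_num) fun k hk =>
      measureReal_lipschitz_tail_le hn hw hμ hL hg hlip hm hk
  have h2 : ∫⁻ x, ENNReal.ofReal (-g x - -m) ∂μ ≤
      ENNReal.ofReal ((1 + 2 * 500000000) * (L * (n : ℝ) ^ ((1 : ℝ) / 4))) :=
    lintegral_ofReal_le_of_tail (by fun_prop) hb (by norm_num) fun k hk =>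
      measureReal_lipschitz_tail_le hn hw hμ hL hg.neg
        (fun x y => by
          have := hlip x y
          rwa [abs_sub_comm, ← neg_sub_neg] at this) (by simpa using hm') hk
  have h3 : ∫⁻ x, ‖g x - m‖ₑ ∂μ ≤
      ENNReal.ofReal (2000000002 * L * (n : ℝ) ^ ((1 : ℝ) / 4)) := by
    calc _ ≤ ∫⁻ x, (ENNReal.ofReal (g x - m) + ENNReal.ofReal (-g x - -m)) ∂μ := by
          refine lintegral_mono fun x => ?_
          rw [Real.enorm_eq_ofReal_abs]
          rcases abs_cases (g x - m) with ⟨h, -⟩ | ⟨h, -⟩ <;> rw [h]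
          · exact le_self_add
          · rw [show -(g x - m) = -g x - -m by ring]
            exact le_add_self
      _ ≤ _ := by
          rw [lintegral_add_left (by fun_prop)]
          refine (add_le_add h1 h2).trans_eq ?_
          rw [← ENNReal.ofReal_add (by positivity) (by positivity)]
          congr 1
          ring
  have hint : Integrable (fun x => g x - m) μ :=
    ⟨by fun_prop, h3.trans_lt ENNReal.ofReal_lt_top⟩
  have hint' : Integrable g μ :=
    (hint.add (integrable_const m)).congr (ae_of_all _ fun x => by simp)
  have h4 : (∫ x, g x ∂μ) - m = ∫ x, (g x - m) ∂μ := by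
    rw [integral_sub hint' (integrable_const m)]
    simp
  rw [h4, ← Real.norm_eq_abs, ← toReal_enorm]
  exact ENNReal.toReal_le_of_le_ofReal (by positivity)
    ((enorm_integral_le_lintegral_enorm _).trans h3)

/-! ### Logconcave densities on `ℝⁿ` -/

lemma IsLogConcave.mul_le_midpoint {n : ℕ} {p : En n → ℝ} (hp : IsLogConcave p) (x y : En n) :
    p x * p y ≤ p ((2⁻¹ : ℝ) • (x + y)) ^ 2 := by
  have h := hp.2 x y 2⁻¹ (by norm_num) (by norm_num)
  have h2 : (1 - 2⁻¹ : ℝ) = 2⁻¹ := by norm_num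
  rw [h2, ← smul_add, ← mul_rpow (hp.1 x) (hp.1 y)] at h
  have hxy : 0 ≤ p x * p y := mul_nonneg (hp.1 x) (hp.1 y)
  calc p x * p y = ((p x * p y) ^ (2⁻¹ : ℝ)) ^ 2 := by
        rw [← rpow_natCast, ← rpow_mul hxy]
        norm_num
    _ ≤ _ := by gcongr

lemma IsLogConcave.convex_support {n : ℕ} {p : En n → ℝ} (hp : IsLogConcave p) :
    Convex ℝ (Function.support p) := by
  intro x hx y hy a b ha hb hab
  obtain rfl : b = 1 - a := by linarith
  have hx' : 0 < p x := (hp.1 x).lt_of_ne' hx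
  have hy' : 0 < p y := (hp.1 y).lt_of_ne' hy
  have h : 0 < p x ^ a * p y ^ (1 - a) := by positivity
  exact (h.trans_le (hp.2 x y a ha (by linarith))).ne'

lemma IsLogConcave.concaveOn_log {n : ℕ} {p : En n → ℝ} (hp : IsLogConcave p) :
    ConcaveOn ℝ (Function.support p) fun x => log (p x) := by
  refine ⟨hp.convex_support, fun x hx y hy a b ha hb hab => ?_⟩
  obtain rfl : b = 1 - a := by linarith
  have hx' : 0 < p x := (hp.1 x).lt_of_ne' hx
  have hy' : 0 < p y := (hp.1 y).lt_of_ne' hy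
  have h := log_le_log (by positivity) (hp.2 x y a ha (by linarith))
  rwa [log_mul (by positivity) (by positivity), log_rpow hx', log_rpow hy'] at h

lemma IsLogConcave.continuousOn_interior_support {n : ℕ} {p : En n → ℝ} (hp : IsLogConcave p) :
    ContinuousOn p (interior (Function.support p)) := by
  refine (continuous_exp.comp_continuousOn hp.concaveOn_log.continuousOn_interior).congr
    fun x hx => ?_
  exact (exp_log ((hp.1 x).lt_of_ne' (interior_subset hx))).symm

/-- A logconcave function has a measurable version that is still logconcave: its restriction to the
interior of its support. -/
lemma IsLogConcave.exists_isMidLogConcave {n : ℕ} {p : En n → ℝ} (hp : IsLogConcave p) :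
    ∃ w, IsMidLogConcave w ∧ w =ᵐ[volume] fun x => ENNReal.ofReal (p x) := by
  set U := interior (Function.support p)
  have hU : IsOpen U := isOpen_interior
  refine ⟨fun x => ENNReal.ofReal (U.indicator p x), ⟨?_, fun x y => ?_⟩, ?_⟩
  · refine ENNReal.measurable_ofReal.comp ?_
    classical
    rw [← Set.piecewise_eq_indicator]
    exact hp.continuousOn_interior_support.measurable_piecewise continuousOn_const
      hU.measurableSet
  · by_cases hx : x ∈ U
    · by_cases hy : y ∈ U
      · have hxy : (2⁻¹ : ℝ) • (x + y) ∈ U := by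
          rw [smul_add]
          exact hp.convex_support.interior hx hy (by norm_num) (by norm_num) (by norm_num)
        rw [Set.indicator_of_mem hx, Set.indicator_of_mem hy, Set.indicator_of_mem hxy,
          ← ENNReal.ofReal_mul (hp.1 x), ← ENNReal.ofReal_pow (hp.1 _)]
        exact ENNReal.ofReal_le_ofReal (hp.mul_le_midpoint x y)
      · simp [hy]
    · simp [hx]
  · have h0 := hp.convex_support.addHaar_frontier volume
    filter_upwards [measure_eq_zero_iff_ae_notMem.1 h0] with x hx
    congr 1
    by_cases hxU : x ∈ U
    · exact Set.indicator_of_mem hxU p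
    · rw [Set.indicator_of_notMem hxU]
      by_contra hne
      exact hx ⟨subset_closure (Ne.symm hne), hxU⟩

lemma integral_withDensity_ofReal {n : ℕ} {p : En n → ℝ} (hp : ∀ x, 0 ≤ p x)
    (hpi : Integrable p) (g : En n → ℝ) :
    ∫ x, g x ∂(volume.withDensity fun x => ENNReal.ofReal (p x)) = ∫ x, g x * p x := by
  rw [integral_withDensity_eq_integral_toReal_smul₀ hpi.aemeasurable.ennreal_ofReal
    (ae_of_all _ fun x => ENNReal.ofReal_lt_top)]
  refine integral_congr_ae (ae_of_all _ fun x => ?_)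
  simp only [ENNReal.toReal_ofReal (hp x), smul_eq_mul, mul_comm]

lemma measureReal_withDensity_ofReal {n : ℕ} {p : En n → ℝ} (hp : ∀ x, 0 ≤ p x)
    (hpi : Integrable p) {S : Set (En n)} (hS : MeasurableSet S) :
    (volume.withDensity fun x => ENNReal.ofReal (p x)).real S = pmeas p S := by
  rw [measureReal_def, withDensity_apply _ hS,
    ← ofReal_integral_eq_lintegral_ofReal hpi.integrableOn (ae_of_all _ hp),
    ENNReal.toReal_ofReal (integral_nonneg hp), pmeas]

lemma IsDensity.isProbabilityMeasure {n : ℕ} {p : En n → ℝ} (hp : ∀ x, 0 ≤ p x)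
    (hd : IsDensity p) :
    IsProbabilityMeasure (volume.withDensity fun x => ENNReal.ofReal (p x)) := by
  refine ⟨?_⟩
  rw [withDensity_apply _ MeasurableSet.univ, setLIntegral_univ,
    ← ofReal_integral_eq_lintegral_ofReal hd.1 (ae_of_all _ hp), hd.2, ENNReal.ofReal_one]

lemma IsIsotropic.integral_mul {n : ℕ} {p : En n → ℝ} (hp : IsIsotropic p) (i j : Fin n) :
    ∫ x, p x * (x i * x j) = if i = j then 1 else 0 := by
  have h := congrFun (congrFun hp.2 i) j
  simpa [pcov, hp.1, Matrix.one_apply] using h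

lemma IsIsotropic.integrable_mul {n : ℕ} {p : En n → ℝ} (hp0 : ∀ x, 0 ≤ p x)
    (hpi : Integrable p) (hp : IsIsotropic p) (i j : Fin n) :
    Integrable fun x => p x * (x i * x j) := by
  have hii : ∀ i, Integrable fun x => p x * (x i * x i) := fun i => by
    refine Integrable.of_integral_ne_zero ?_
    simp [hp.integral_mul]
  refine ((hii i).add (hii j)).mono' ?_ (ae_of_all _ fun x => ?_)
  · exact hpi.aestronglyMeasurable.mul (by fun_prop)
  · rw [norm_mul, Real.norm_of_nonneg (hp0 x), Pi.add_apply, ← mul_add]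
    refine mul_le_mul_of_nonneg_left ?_ (hp0 x)
    rw [Real.norm_eq_abs, abs_le]
    constructor <;> nlinarith [sq_nonneg (x i + x j), sq_nonneg (x i - x j)]

lemma IsIsotropic.isSubIsotropic {n : ℕ} {p : En n → ℝ} (hp0 : ∀ x, 0 ≤ p x)
    (hpi : Integrable p) (hp : IsIsotropic p) :
    IsSubIsotropic (volume.withDensity fun x => ENNReal.ofReal (p x)) := by
  intro u
  have hsum : ∀ x : En n, p x * ⟪u, x⟫ ^ 2 = ∑ i, ∑ j, u i * u j * (p x * (x i * x j)) := by
    intro x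
    rw [PiLp.inner_apply, sq, Finset.sum_mul_sum, Finset.mul_sum]
    refine Finset.sum_congr rfl fun i _ => ?_
    rw [Finset.mul_sum]
    refine Finset.sum_congr rfl fun j _ => ?_
    simp only [RCLike.inner_apply, conj_trivial]
    ring
  have hint : ∀ i j, Integrable fun x : En n => u i * u j * (p x * (x i * x j)) :=
    fun i j => (hp.integrable_mul hp0 hpi i j).const_mul _
  rw [lintegral_withDensity_eq_lintegral_mul₀ hpi.aemeasurable.ennreal_ofReal (by fun_prop)]
  simp only [Pi.mul_apply, ← ENNReal.ofReal_mul (hp0 _), hsum]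
  rw [← ofReal_integral_eq_lintegral_ofReal
    (integrable_finsetSum _ fun i _ => integrable_finsetSum _ fun j _ => hint i j)
    (ae_of_all _ fun x => by
      simp only [← hsum]
      exact mul_nonneg (hp0 x) (sq_nonneg _))]
  refine ENNReal.ofReal_le_ofReal (le_of_eq ?_)
  rw [integral_finsetSum _ fun i _ => integrable_finsetSum _ fun j _ => hint i j]
  simp_rw [integral_finsetSum _ fun j _ => hint _ j, integral_const_mul, hp.integral_mul]
  rw [EuclideanSpace.norm_sq_eq]
  simp [sq]

/-- For a constant function, the mean agrees with every median. -/
lemma integral_eq_median_of_const {n : ℕ} {p g : En n → ℝ} {m c : ℝ} (hd : IsDensity p)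
    (hg : ∀ x, g x = c) (hm : IsMedian p g m) : ∫ x, g x * p x = m := by
  have hcm : c = m := by
    obtain ⟨h1, h2⟩ := hm
    simp only [hg, pmeas] at h1 h2
    refine le_antisymm ?_ ?_ <;> by_contra hlt
    · norm_num [hlt] at h2
    · norm_num [hlt] at h1
  simp only [hg, integral_const_mul, hd.2, mul_one, hcm]

/-- For an isotropic logconcave density `p` and an `L`-Lipschitz `g`, the
mean and any median of `g` under `p` differ by at most `C·L·n^{1/4}`. -/
theorem mean_median_close :
    ∃ C : ℝ, 0 < C ∧
      ∀ (n : ℕ) (p : En n → ℝ) (L : ℝ) (g : En n → ℝ) (m : ℝ),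
        IsLogConcave p → IsDensity p → IsIsotropic p →
        (∀ x y, |g x - g y| ≤ L * ‖x - y‖) →
        IsMedian p g m →
        |(∫ x, g x * p x) - m| ≤ C * L * (n : ℝ) ^ ((1 : ℝ) / 4) := by
  refine ⟨2000000002, by norm_num, fun n p L g m hlc hd hiso hlip hmed => ?_⟩
  have hconst : (∀ x, g x = g 0) → 0 ≤ 2000000002 * L * (n : ℝ) ^ ((1 : ℝ) / 4) →
      |(∫ x, g x * p x) - m| ≤ 2000000002 * L * (n : ℝ) ^ ((1 : ℝ) / 4) := by
    intro hg h0
    rwa [integral_eq_median_of_const hd hg hmed, sub_self, abs_zero]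
  rcases Nat.eq_zero_or_pos n with rfl | hn
  · refine hconst (fun x => by rw [Subsingleton.elim x 0]) ?_
    rw [Nat.cast_zero, zero_rpow (by norm_num), mul_zero]
  have hL : 0 ≤ L := by
    have : Nonempty (Fin n) := ⟨⟨0, hn⟩⟩
    obtain ⟨x, hx⟩ := exists_ne (0 : En n)
    have h := (abs_nonneg _).trans (hlip x 0)
    rw [sub_zero] at h
    exact nonneg_of_mul_nonneg_left h (norm_pos_iff.2 hx)
  rcases hL.eq_or_lt with rfl | hL
  · refine hconst (fun x => ?_) (by simp)
    have h := hlip x 0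
    rw [zero_mul] at h
    exact sub_eq_zero.1 (abs_nonpos_iff.1 h)
  have hg : Measurable g :=
    (LipschitzWith.of_dist_le_mul (K := ⟨L, hL.le⟩) fun x y => by
      rw [Real.dist_eq, dist_eq_norm]
      exact hlip x y).continuous.measurable
  obtain ⟨w, hw, hwp⟩ := hlc.exists_isMidLogConcave
  have hμ := withDensity_congr_ae hwp
  have : IsProbabilityMeasure (volume.withDensity w) := hμ ▸ hd.isProbabilityMeasure hlc.1
  have key := abs_integral_sub_median_le hn hw (hμ ▸ hiso.isSubIsotropic hlc.1 hd.1) hL hg hlip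
    (m := m)
  rw [hμ, measureReal_withDensity_ofReal hlc.1 hd.1 (measurableSet_le hg measurable_const),
    measureReal_withDensity_ofReal hlc.1 hd.1 (measurableSet_le measurable_const hg),
    integral_withDensity_ofReal hlc.1 hd.1] at key
  exact key hmed.2 hmed.1
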